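/- Theorem 1 (uniqueness part of the Bellman optimality equation for the Bayesian value function): The Bayesian Bellman operator T is a γ^K-contraction in the supremum norm, i.e. for all functions V, W : S → ℝ one has max_{s∈S} |(T V)(s) − (T W)(s)| ≤ γ^K · max_{s∈S} |V(s) − W(s)|, and consequently the fixed-point equation V = T V has exactly one solution V* : S → ℝ. -/

import Mathlib

open MeasureTheory Finset

/-- The prediction-conditioned one-step kernel: `σₖ((s,a),s')` if `a` is in the
predictable action subset `A⁻`, and `P(s'|s,a)` otherwise. -/
def condKernel {S A : Type*} [DecidableEq A] (P : S → A → S → ℝ) (Aminus : Finset A)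
    (σk : S × {a : A // a ∈ Aminus} → S → ℝ) (s : S) (a : A) (s' : S) : ℝ :=
  if h : a ∈ Aminus then σk (s, ⟨a, h⟩) s' else P s a s'

/-- The multi-step kernel `P(s_t | s, a_{0:t−1}, σ_{1:t})`, defined recursively:
`P(s₀ = s' | s) = 1{s' = s}` and
`P(s_{t+1}|s,a_{0:t},σ_{1:t+1}) = ∑_{s_t} P(s_{t+1}|s_t,a_t,σ_{t+1}) P(s_t|s,a_{0:t−1},σ_{1:t})`.
(Here `σ t` stands for `σ_{t+1}` and `a t` for `a_t`, both `0`-indexed.) -/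
def multiKernel {S A : Type*} [Fintype S] [DecidableEq S] [DecidableEq A]
    (P : S → A → S → ℝ) (Aminus : Finset A)
    (σ : ℕ → S × {a : A // a ∈ Aminus} → S → ℝ) (s : S) (a : ℕ → A) :
    ℕ → S → ℝ
  | 0 => fun s' => if s' = s then 1 else 0
  | (t + 1) => fun s' =>
      ∑ st : S, condKernel P Aminus (σ t) st (a t) s' * multiKernel P Aminus σ s a t st

/-- The space `Q_K` of `K`-step predictions: tuples `σ = (σ₁,…,σ_K)` of
row-stochastic matrices `σₖ : (S × A⁻) × S → ℝ`.  It carries the Borel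
(sub-)σ-algebra inherited from the ambient finite-dimensional real vector
space of all such tuples of matrices. -/
def PredSpace (S A : Type*) [Fintype S] (Aminus : Finset A) (K : ℕ) : Type _ :=
  {σ : Fin K → S × {a : A // a ∈ Aminus} → S → ℝ //
    (∀ k p s', 0 ≤ σ k p s') ∧ (∀ k p, ∑ s', σ k p s' = 1)}

noncomputable instance (S A : Type*) [Fintype S] (Aminus : Finset A) (K : ℕ) :
    MeasurableSpace (PredSpace S A Aminus K) :=
  Subtype.instMeasurableSpace

/-- The Bayesian Bellman operator
`(T V)(s) = ∫_{Q_K} max_{a ∈ A^K} [ ∑_{t<K} γ^t ∑_{s_t} P(s_t|s,a_{0:t−1},σ_{1:t}) r(s_t,a_t)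
  + γ^K ∑_{s_K} P(s_K|s,a,σ) V(s_K) ] dμ(σ)`. -/
noncomputable def bellmanT {S A : Type*}
    [Fintype S] [DecidableEq S] [Fintype A] [DecidableEq A] [Nonempty A]
    (γ : ℝ) (r : S × A → ℝ) (P : S → A → S → ℝ) (Aminus : Finset A)
    (K : ℕ) (hK : 0 < K)
    (μ : Measure (PredSpace S A Aminus K)) (V : S → ℝ) (s : S) : ℝ :=
  ∫ σ, Finset.univ.sup' Finset.univ_nonempty
      (fun a : Fin K → A =>
        (∑ t ∈ Finset.range K, γ ^ t *
            ∑ st : S,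
              multiKernel P Aminus (fun u => σ.1 ⟨u % K, Nat.mod_lt u hK⟩) s
                  (fun u => a ⟨u % K, Nat.mod_lt u hK⟩) t st *
                r (st, a ⟨t % K, Nat.mod_lt t hK⟩))
          + γ ^ K *
            ∑ sK : S,
              multiKernel P Aminus (fun u => σ.1 ⟨u % K, Nat.mod_lt u hK⟩) s
                  (fun u => a ⟨u % K, Nat.mod_lt u hK⟩) K sK *
                V sK) ∂μ

lemma condKernel_nonneg {S A : Type*} [DecidableEq A] {P : S → A → S → ℝ} {Aminus : Finset A}
    {σk : S × {a : A // a ∈ Aminus} → S → ℝ} (hP : ∀ s a s', 0 ≤ P s a s')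
    (hσ : ∀ p s', 0 ≤ σk p s') (s : S) (a : A) (s' : S) :
    0 ≤ condKernel P Aminus σk s a s' := by
  unfold condKernel
  split_ifs
  exacts [hσ _ _, hP _ _ _]

lemma sum_condKernel {S A : Type*} [Fintype S] [DecidableEq A] {P : S → A → S → ℝ}
    {Aminus : Finset A} {σk : S × {a : A // a ∈ Aminus} → S → ℝ}
    (hP : ∀ s a, ∑ s', P s a s' = 1) (hσ : ∀ p, ∑ s', σk p s' = 1) (s : S) (a : A) :
    ∑ s', condKernel P Aminus σk s a s' = 1 := by
  unfold condKernel
  split_ifs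
  exacts [hσ _, hP _ _]

section MultiKernel

variable {S A : Type*} [Fintype S] [DecidableEq S] [DecidableEq A] {P : S → A → S → ℝ}
  {Aminus : Finset A} {σ : ℕ → S × {a : A // a ∈ Aminus} → S → ℝ}

lemma multiKernel_nonneg (hP : ∀ s a s', 0 ≤ P s a s') (hσ : ∀ t p s', 0 ≤ σ t p s')
    (s : S) (a : ℕ → A) (t : ℕ) (s' : S) : 0 ≤ multiKernel P Aminus σ s a t s' := by
  induction t generalizing s' with
  | zero => simp only [multiKernel]; split_ifs <;> norm_num
  | succ t ih =>
    exact Finset.sum_nonneg fun st _ =>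
      mul_nonneg (condKernel_nonneg hP (hσ t) _ _ _) (ih st)

lemma sum_multiKernel (hP : ∀ s a, ∑ s', P s a s' = 1) (hσ : ∀ t p, ∑ s', σ t p s' = 1)
    (s : S) (a : ℕ → A) (t : ℕ) : ∑ s', multiKernel P Aminus σ s a t s' = 1 := by
  induction t with
  | zero => simp [multiKernel]
  | succ t ih =>
    simp only [multiKernel]
    rw [Finset.sum_comm]
    simp only [← Finset.sum_mul, sum_condKernel hP (hσ t), one_mul, ih]

lemma abs_sum_multiKernel_mul_le (hP0 : ∀ s a s', 0 ≤ P s a s')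
    (hP1 : ∀ s a, ∑ s', P s a s' = 1) (hσ0 : ∀ t p s', 0 ≤ σ t p s')
    (hσ1 : ∀ t p, ∑ s', σ t p s' = 1) (s : S) (a : ℕ → A) (t : ℕ) {f : S → ℝ} {C : ℝ}
    (hf : ∀ s', |f s'| ≤ C) : |∑ s', multiKernel P Aminus σ s a t s' * f s'| ≤ C := by
  calc |∑ s', multiKernel P Aminus σ s a t s' * f s'|
      ≤ ∑ s', |multiKernel P Aminus σ s a t s' * f s'| := Finset.abs_sum_le_sum_abs _ _
    _ ≤ ∑ s', multiKernel P Aminus σ s a t s' * C := by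
        refine Finset.sum_le_sum fun s' _ => ?_
        have h := multiKernel_nonneg hP0 hσ0 s a t s'
        rw [abs_mul, abs_of_nonneg h]
        exact mul_le_mul_of_nonneg_left (hf s') h
    _ = C := by rw [← Finset.sum_mul, sum_multiKernel hP1 hσ1, one_mul]

lemma measurable_multiKernel {Ω : Type*} [MeasurableSpace Ω]
    {τ : Ω → ℕ → S × {a : A // a ∈ Aminus} → S → ℝ}
    (hτ : ∀ t p s', Measurable fun ω => τ ω t p s') (s : S) (a : ℕ → A) (t : ℕ) (s' : S) :
    Measurable fun ω => multiKernel P Aminus (τ ω) s a t s' := by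
  induction t generalizing s' with
  | zero => exact measurable_const
  | succ t ih =>
    refine Finset.measurable_sum _ fun st _ => Measurable.mul ?_ (ih st)
    unfold condKernel
    split_ifs
    exacts [hτ _ _ _, measurable_const]

end MultiKernel

lemma abs_sup'_sub_sup'_le {ι : Type*} {s : Finset ι} (hs : s.Nonempty) {f g : ι → ℝ} {C : ℝ}
    (h : ∀ i ∈ s, |f i - g i| ≤ C) : |s.sup' hs f - s.sup' hs g| ≤ C := by
  rw [abs_sub_le_iff, sub_le_iff_le_add, sub_le_iff_le_add]
  constructor <;> refine Finset.sup'_le hs _ fun i hi => ?_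
  · linarith [(abs_le.1 (h i hi)).2, Finset.le_sup' g hi]
  · linarith [(abs_le.1 (h i hi)).1, Finset.le_sup' f hi]

section Bellman

variable {S A : Type*} [Fintype S] [DecidableEq S] [DecidableEq A]

/-- The expected discounted return of the open-loop action sequence `a` from the state `s` under
the prediction `σ`, with terminal value `V`. -/
noncomputable def predictedReturn (γ : ℝ) (r : S × A → ℝ) (P : S → A → S → ℝ)
    (Aminus : Finset A) (K : ℕ) (hK : 0 < K) (V : S → ℝ) (s : S)
    (σ : PredSpace S A Aminus K) (a : Fin K → A) : ℝ :=
  (∑ t ∈ Finset.range K, γ ^ t *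
      ∑ st : S,
        multiKernel P Aminus (fun u => σ.1 ⟨u % K, Nat.mod_lt u hK⟩) s
            (fun u => a ⟨u % K, Nat.mod_lt u hK⟩) t st *
          r (st, a ⟨t % K, Nat.mod_lt t hK⟩))
    + γ ^ K *
      ∑ sK : S,
        multiKernel P Aminus (fun u => σ.1 ⟨u % K, Nat.mod_lt u hK⟩) s
            (fun u => a ⟨u % K, Nat.mod_lt u hK⟩) K sK *
          V sK

variable {γ : ℝ} {r : S × A → ℝ} {P : S → A → S → ℝ} {Aminus : Finset A} {K : ℕ} {hK : 0 < K}

lemma measurable_predictedReturn (V : S → ℝ) (s : S) (a : Fin K → A) :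
    Measurable fun σ => predictedReturn γ r P Aminus K hK V s σ a := by
  have hτ : ∀ (t : ℕ) (p : S × {a : A // a ∈ Aminus}) (s' : S),
      Measurable fun σ : PredSpace S A Aminus K => σ.1 ⟨t % K, Nat.mod_lt t hK⟩ p s' := by
    intro t p s'
    have h : Measurable fun σ : PredSpace S A Aminus K => σ.1 := measurable_subtype_coe
    exact (measurable_pi_apply s').comp ((measurable_pi_apply p).comp
      ((measurable_pi_apply _).comp h))
  have hm := fun t s' => measurable_multiKernel (P := P) hτ s
    (fun u => a ⟨u % K, Nat.mod_lt u hK⟩) t s'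
  unfold predictedReturn
  refine Measurable.add (Finset.measurable_sum _ fun t _ => Measurable.const_mul ?_ _)
    (Measurable.const_mul ?_ _)
  · exact Finset.measurable_sum _ fun s' _ => (hm t s').mul_const _
  · exact Finset.measurable_sum _ fun s' _ => (hm K s').mul_const _

lemma abs_predictedReturn_sub_le (hγ : 0 ≤ γ) (hP0 : ∀ s a s', 0 ≤ P s a s')
    (hP1 : ∀ s a, ∑ s', P s a s' = 1) (V W : S → ℝ) (s : S) (σ : PredSpace S A Aminus K)
    (a : Fin K → A) :
    |predictedReturn γ r P Aminus K hK V s σ a - predictedReturn γ r P Aminus K hK W s σ a|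
      ≤ γ ^ K * dist V W := by
  unfold predictedReturn
  rw [add_sub_add_left_eq_sub, ← mul_sub, ← Finset.sum_sub_distrib, abs_mul,
    abs_of_nonneg (pow_nonneg hγ K)]
  simp only [← mul_sub]
  exact mul_le_mul_of_nonneg_left
    (abs_sum_multiKernel_mul_le hP0 hP1 (fun _ => σ.2.1 _) (fun _ => σ.2.2 _) _ _ _
      fun s' => dist_le_pi_dist V W s') (pow_nonneg hγ K)

lemma abs_predictedReturn_le [Fintype A] (hγ : 0 ≤ γ) (hP0 : ∀ s a s', 0 ≤ P s a s')
    (hP1 : ∀ s a, ∑ s', P s a s' = 1) (V : S → ℝ) (s : S) (σ : PredSpace S A Aminus K)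
    (a : Fin K → A) :
    |predictedReturn γ r P Aminus K hK V s σ a|
      ≤ (∑ t ∈ Finset.range K, γ ^ t * ‖r‖) + γ ^ K * ‖V‖ := by
  have key : ∀ (t : ℕ) (f : S → ℝ) (C : ℝ), (∀ s', |f s'| ≤ C) → |γ ^ t * ∑ s',
      multiKernel P Aminus (fun u => σ.1 ⟨u % K, Nat.mod_lt u hK⟩) s
        (fun u => a ⟨u % K, Nat.mod_lt u hK⟩) t s' * f s'| ≤ γ ^ t * C := by
    intro t f C hf
    rw [abs_mul, abs_of_nonneg (pow_nonneg hγ t)]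
    exact mul_le_mul_of_nonneg_left
      (abs_sum_multiKernel_mul_le hP0 hP1 (fun _ => σ.2.1 _) (fun _ => σ.2.2 _) _ _ _ hf)
      (pow_nonneg hγ t)
  refine (abs_add_le _ _).trans (add_le_add ?_ (key K V _ fun s' => norm_le_pi_norm V s'))
  exact (Finset.abs_sum_le_sum_abs _ _).trans
    (Finset.sum_le_sum fun t _ => key t _ _ fun s' => norm_le_pi_norm r _)

variable [Fintype A] [Nonempty A] {μ : Measure (PredSpace S A Aminus K)}

lemma integrable_sup'_predictedReturn [IsFiniteMeasure μ] (hγ : 0 ≤ γ)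
    (hP0 : ∀ s a s', 0 ≤ P s a s') (hP1 : ∀ s a, ∑ s', P s a s' = 1) (V : S → ℝ) (s : S) :
    Integrable (fun σ => Finset.univ.sup' Finset.univ_nonempty
      (predictedReturn γ r P Aminus K hK V s σ)) μ := by
  refine Integrable.of_bound (C := (∑ t ∈ Finset.range K, γ ^ t * ‖r‖) + γ ^ K * ‖V‖) ?_
    (Filter.Eventually.of_forall fun σ => ?_)
  · have h := Finset.measurable_sup' (Finset.univ_nonempty (α := Fin K → A))
      fun a _ => measurable_predictedReturn (γ := γ) (r := r) (P := P) (Aminus := Aminus)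
        (hK := hK) V s a
    refine Measurable.aestronglyMeasurable ?_
    convert h using 1
    ext σ
    simp only [Finset.sup'_apply]
  · obtain ⟨a, -, ha⟩ := Finset.exists_mem_eq_sup' (Finset.univ_nonempty (α := Fin K → A))
      (predictedReturn γ r P Aminus K hK V s σ)
    rw [ha]
    exact abs_predictedReturn_le hγ hP0 hP1 V s σ a

lemma abs_bellmanT_sub_le [IsProbabilityMeasure μ] (hγ : 0 ≤ γ)
    (hP0 : ∀ s a s', 0 ≤ P s a s') (hP1 : ∀ s a, ∑ s', P s a s' = 1) (V W : S → ℝ) (s : S) :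
    |bellmanT γ r P Aminus K hK μ V s - bellmanT γ r P Aminus K hK μ W s|
      ≤ γ ^ K * dist V W := by
  change |(∫ σ, Finset.univ.sup' Finset.univ_nonempty
      (predictedReturn γ r P Aminus K hK V s σ) ∂μ) - ∫ σ, Finset.univ.sup' Finset.univ_nonempty
      (predictedReturn γ r P Aminus K hK W s σ) ∂μ| ≤ _
  rw [← integral_sub (integrable_sup'_predictedReturn hγ hP0 hP1 V s)
    (integrable_sup'_predictedReturn hγ hP0 hP1 W s)]
  have h : ∀ σ, ‖Finset.univ.sup' Finset.univ_nonempty (predictedReturn γ r P Aminus K hK V s σ) -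
      Finset.univ.sup' Finset.univ_nonempty (predictedReturn γ r P Aminus K hK W s σ)‖
        ≤ γ ^ K * dist V W := fun σ =>
    abs_sup'_sub_sup'_le _ fun a _ => abs_predictedReturn_sub_le hγ hP0 hP1 V W s σ a
  refine (norm_integral_le_of_norm_le_const (ae_of_all μ h)).trans_eq ?_
  rw [probReal_univ, mul_one]

lemma contractingWith_bellmanT [IsProbabilityMeasure μ] (hγ0 : 0 ≤ γ) (hγ1 : γ < 1)
    (hP0 : ∀ s a s', 0 ≤ P s a s') (hP1 : ∀ s a, ∑ s', P s a s' = 1) :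
    ContractingWith (γ.toNNReal ^ K) (bellmanT γ r P Aminus K hK μ) := by
  refine ⟨pow_lt_one₀ zero_le (Real.toNNReal_lt_one.2 hγ1) hK.ne',
    LipschitzWith.of_dist_le_mul fun V W => ?_⟩
  rw [NNReal.coe_pow, Real.coe_toNNReal γ hγ0]
  exact (dist_pi_le_iff (by positivity)).2 fun s => abs_bellmanT_sub_le hγ0 hP0 hP1 V W s

end Bellman

/-- **Theorem 1 (uniqueness part).** The Bayesian Bellman operator `T` is a
`γ^K`-contraction in the supremum norm: for all `V W : S → ℝ`,
`max_s |(T V)(s) − (T W)(s)| ≤ γ^K max_s |V(s) − W(s)|`; consequently the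
fixed-point equation `V = T V` has exactly one solution. -/
theorem bayesianBellman_contraction_uniqueFixedPoint {S A : Type*}
    [Fintype S] [DecidableEq S] [Nonempty S]
    [Fintype A] [DecidableEq A] [Nonempty A]
    (γ : ℝ) (hγ0 : 0 < γ) (hγ1 : γ < 1)
    (r : S × A → ℝ) (P : S → A → S → ℝ)
    (hP0 : ∀ s a s', 0 ≤ P s a s') (hP1 : ∀ s a, ∑ s', P s a s' = 1)
    (K : ℕ) (hK : 0 < K) (Aminus : Finset A)
    (μ : Measure (PredSpace S A Aminus K)) [IsProbabilityMeasure μ] :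
    (∀ V W : S → ℝ,
        (Finset.univ.sup' Finset.univ_nonempty fun s : S =>
            |bellmanT γ r P Aminus K hK μ V s - bellmanT γ r P Aminus K hK μ W s|)
          ≤ γ ^ K *
            Finset.univ.sup' Finset.univ_nonempty fun s : S => |V s - W s|)
      ∧ ∃! Vstar : S → ℝ, bellmanT γ r P Aminus K hK μ Vstar = Vstar := by
  refine ⟨fun V W => Finset.sup'_le _ _ fun s _ => ?_, ?_⟩
  · refine (abs_bellmanT_sub_le hγ0.le hP0 hP1 V W s).trans
      (mul_le_mul_of_nonneg_left ?_ (pow_nonneg hγ0.le K))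
    exact (dist_pi_le_iff').2 fun s' =>
      Finset.le_sup' (fun s : S => |V s - W s|) (Finset.mem_univ s')
  · have h := contractingWith_bellmanT (r := r) (hK := hK) (μ := μ) hγ0.le hγ1 hP0 hP1
    exact ⟨h.fixedPoint, h.fixedPoint_isFixedPt, fun V hV => h.fixedPoint_unique hV⟩
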